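/- A finite group G is autonilpotent if and only if every automorphism α ∈ Aut G fixes every element g ∈ G whose order is coprime to the order of α, i.e., gcd(ord(g), ord(α)) = 1 implies α(g) = g. -/

import Mathlib

/-- The autocommutator `[x, α] = x⁻¹ · α(x)`. -/
def autoComm {G : Type*} [Group G] (x : G) (α : MulAut G) : G := x⁻¹ * α x

/-- `autoL G n = Lₙ(G)`: elements `x` with `[x, α₁, …, αₙ] = 1` for all `α₁, …, αₙ ∈ Aut G`. -/
def autoL (G : Type*) [Group G] (n : ℕ) : Set G :=
  {x | ∀ l : List (MulAut G), l.length = n → l.foldl autoComm x = 1}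

/-- A group is autonilpotent if `G = Lₙ(G)` for some `n`. -/
def Autonilpotent (G : Type*) [Group G] : Prop := ∃ n : ℕ, ∀ x : G, x ∈ autoL G n

section AutoSeries

variable {G : Type*} [Group G]

theorem mem_autoL_zero {x : G} : x ∈ autoL G 0 ↔ x = 1 := by
  simp [autoL]

theorem mem_autoL_succ {n : ℕ} {x : G} :
    x ∈ autoL G (n + 1) ↔ ∀ α : MulAut G, x⁻¹ * α x ∈ autoL G n := by
  constructor
  · intro h α l hl
    exact h (α :: l) (by simp [hl])
  · rintro h (_ | ⟨α, l⟩) hl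
    · simp at hl
    · exact h α l (by simpa using hl)

/-- For an `Aut G`-invariant subgroup `H`, the subgroup of elements whose image in `G ⧸ H` is fixed
by all automorphisms of `G`. -/
def Subgroup.autoStep (H : Subgroup G) (hH : ∀ (α : MulAut G), ∀ x ∈ H, α x ∈ H) :
    Subgroup G where
  carrier := {x | ∀ α : MulAut G, x⁻¹ * α x ∈ H}
  one_mem' α := by simp
  mul_mem' {x y} hx hy α := by
    have h := H.mul_mem (hH (MulAut.conj y⁻¹) _ (hx α)) (hy α)
    simpa [mul_assoc] using h
  inv_mem' {x} hx α := by
    have h := H.inv_mem (hH (MulAut.conj x) _ (hx α))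
    simpa [mul_assoc] using h

theorem exists_subgroup_coe_eq_autoL (G : Type*) [Group G] (n : ℕ) :
    ∃ H : Subgroup G, (H : Set G) = autoL G n ∧ ∀ (α : MulAut G), ∀ x ∈ H, α x ∈ H := by
  induction n with
  | zero =>
    refine ⟨⊥, ?_, ?_⟩
    · ext x
      simp [mem_autoL_zero]
    · intro α x hx
      rw [Subgroup.mem_bot] at hx ⊢
      simp [hx]
  | succ n ih =>
    obtain ⟨H, hH, hinv⟩ := ih
    refine ⟨H.autoStep hinv, ?_, ?_⟩
    · ext x
      rw [mem_autoL_succ, ← hH]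
      rfl
    · intro α x hx β
      have h := hinv α _ (hx (α⁻¹ * β * α))
      simpa using h

/-- The subgroup whose underlying set is `Lₙ(G)`. -/
noncomputable def autoSeries (G : Type*) [Group G] (n : ℕ) : Subgroup G :=
  (exists_subgroup_coe_eq_autoL G n).choose

theorem coe_autoSeries (n : ℕ) : (autoSeries G n : Set G) = autoL G n :=
  (exists_subgroup_coe_eq_autoL G n).choose_spec.1

theorem map_mem_autoSeries {n : ℕ} (α : MulAut G) {x : G} (hx : x ∈ autoSeries G n) :
    α x ∈ autoSeries G n :=
  (exists_subgroup_coe_eq_autoL G n).choose_spec.2 α x hx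

theorem mem_autoSeries_zero {x : G} : x ∈ autoSeries G 0 ↔ x = 1 := by
  rw [← SetLike.mem_coe, coe_autoSeries, mem_autoL_zero]

theorem mem_autoSeries_succ {n : ℕ} {x : G} :
    x ∈ autoSeries G (n + 1) ↔ ∀ α : MulAut G, x⁻¹ * α x ∈ autoSeries G n := by
  simp_rw [← SetLike.mem_coe, coe_autoSeries, mem_autoL_succ]

theorem autoSeries_mono : Monotone (autoSeries G) :=
  monotone_nat_of_le_succ fun _ _ hx => mem_autoSeries_succ.2 fun α =>
    mul_mem (inv_mem hx) (map_mem_autoSeries α hx)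

theorem autonilpotent_iff_exists_autoSeries_eq_top :
    Autonilpotent G ↔ ∃ n, autoSeries G n = ⊤ := by
  simp_rw [Autonilpotent, Subgroup.eq_top_iff', ← SetLike.mem_coe, coe_autoSeries]

theorem Autonilpotent.isNilpotent (h : Autonilpotent G) : Group.IsNilpotent G := by
  obtain ⟨n, hn⟩ := autonilpotent_iff_exists_autoSeries_eq_top.1 h
  refine (Subgroup.nilpotent_iff_finite_ascending_central_series G).2 ⟨n, autoSeries G, ⟨?_, ?_⟩, hn⟩
  · ext x
    rw [mem_autoSeries_zero, Subgroup.mem_bot]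
  · intro x n hx g
    have h := mem_autoSeries_succ.1 (inv_mem hx) (MulAut.conj g)
    simpa [commutatorElement_def, mul_assoc] using h

theorem pow_apply_of_fixed_inv_mul_apply (α : MulAut G) (x : G) (h : α (x⁻¹ * α x) = x⁻¹ * α x)
    (k : ℕ) : (α ^ k) x = x * (x⁻¹ * α x) ^ k := by
  induction k with
  | zero => simp
  | succ k ih =>
    rw [pow_succ', MulAut.mul_apply, ih, map_mul, map_pow, h, pow_succ']
    simp [mul_assoc]

theorem apply_eq_of_mem_autoSeries (P : Subgroup G) (α : MulAut G)
    (hP : ∀ x ∈ P, α x ∈ P) (hα : ∀ x ∈ P, x ^ orderOf α = 1 → x = 1) (n : ℕ) :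
    ∀ x ∈ P, x ∈ autoSeries G n → α x = x := by
  induction n with
  | zero =>
    intro x _ hx
    simp [mem_autoSeries_zero.1 hx]
  | succ n ih =>
    intro x hxP hx
    have hyP : x⁻¹ * α x ∈ P := mul_mem (inv_mem hxP) (hP x hxP)
    have h := pow_apply_of_fixed_inv_mul_apply α x (ih _ hyP (mem_autoSeries_succ.1 hx α))
      (orderOf α)
    rw [pow_orderOf_eq_one, MulAut.one_apply, left_eq_mul] at h
    exact (inv_mul_eq_one.1 (hα _ hyP h)).symm

end AutoSeries

section Sylow

variable {G : Type*} [Group G] [Finite G]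

theorem Subgroup.eq_top_of_forall_exists_sylow_le (H : Subgroup G)
    (h : ∀ p : ℕ, p.Prime → ∃ P : Sylow p G, (P : Subgroup G) ≤ H) : H = ⊤ := by
  rw [← Subgroup.index_eq_one]
  by_contra hne
  obtain ⟨p, hp, hdvd⟩ := Nat.exists_prime_and_dvd hne
  have := Fact.mk hp
  obtain ⟨P, hP⟩ := h p hp
  exact P.not_dvd_index (hdvd.trans (Subgroup.index_dvd_of_le hP))

theorem IsPGroup.coprime_orderOf {p q : ℕ} (hp : p.Prime) (hq : q.Prime) (hpq : p ≠ q)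
    {A B : Type*} [Group A] [Group B] {P : Subgroup A} {Q : Subgroup B}
    (hP : IsPGroup p P) (hQ : IsPGroup q Q) {x : A} {y : B} (hx : x ∈ P) (hy : y ∈ Q) :
    Nat.Coprime (orderOf x) (orderOf y) := by
  have := Fact.mk hp
  have := Fact.mk hq
  obtain ⟨a, ha⟩ := IsPGroup.iff_orderOf.1 hP ⟨x, hx⟩
  obtain ⟨b, hb⟩ := IsPGroup.iff_orderOf.1 hQ ⟨y, hy⟩
  rw [Subgroup.orderOf_mk] at ha hb
  rw [ha, hb]
  exact Nat.Coprime.pow _ _ ((Nat.coprime_primes hp hq).2 hpq)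

theorem Autonilpotent.apply_eq_of_coprime (hG : Autonilpotent G) (α : MulAut G) (g : G)
    (hco : Nat.Coprime (orderOf g) (orderOf α)) : α g = g := by
  obtain ⟨n, hn⟩ := autonilpotent_iff_exists_autoSeries_eq_top.1 hG
  have hnil := hG.isNilpotent
  have hnorm : ∀ (p : ℕ) (_ : Fact p.Prime) (P : Sylow p G), (P : Subgroup G).Normal :=
    ((Group.isNilpotent_of_finite_tfae (G := G)).out 0 3).1 hnil
  let E : Subgroup G := MonoidHom.eqLocus α.toMonoidHom (MonoidHom.id G)
  suffices h : E.subgroupOf (Subgroup.zpowers g) = ⊤ from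
    Subgroup.subgroupOf_eq_top.1 h (Subgroup.mem_zpowers g)
  refine Subgroup.eq_top_of_forall_exists_sylow_le _ fun p hp => ?_
  have := Fact.mk hp
  obtain ⟨Q⟩ : Nonempty (Sylow p (Subgroup.zpowers g)) := inferInstance
  refine ⟨Q, fun x hx => ?_⟩
  rw [Subgroup.mem_subgroupOf]
  change α x = x
  by_cases hx1 : (x : G) = 1
  · simp [hx1]
  obtain ⟨P, hP⟩ := (Q.isPGroup'.map (Subgroup.zpowers g).subtype).exists_le_sylow
  have := hnorm p this P
  have := P.characteristic_of_normal this
  have hxP : (x : G) ∈ (P : Subgroup G) := hP ⟨x, hx, rfl⟩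
  obtain ⟨a, ha⟩ := IsPGroup.iff_orderOf.1 P.isPGroup' ⟨x, hxP⟩
  rw [Subgroup.orderOf_mk] at ha
  have ha0 : a ≠ 0 := by
    rintro rfl
    exact hx1 (orderOf_eq_one_iff.1 (by simpa using ha))
  have hpα : Nat.Coprime p (orderOf α) := by
    refine hco.coprime_dvd_left ((dvd_pow_self p ha0).trans ?_)
    rw [← ha]
    exact orderOf_dvd_of_mem_zpowers x.2
  refine apply_eq_of_mem_autoSeries P α ?_ ?_ n x hxP (by simp [hn])
  · intro y hy
    exact Subgroup.mem_comap.1 ((Subgroup.characteristic_iff_le_comap.1 this α) hy)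
  · intro y hy hy1
    obtain ⟨b, hb⟩ := IsPGroup.iff_orderOf.1 P.isPGroup' ⟨y, hy⟩
    rw [Subgroup.orderOf_mk] at hb
    have h := orderOf_dvd_of_pow_eq_one hy1
    rw [hb] at h
    rw [← orderOf_eq_one_iff, hb]
    exact Nat.Coprime.eq_one_of_dvd (hpα.pow_left b) h

theorem Sylow.normal_of_coprime_apply_eq
    (h : ∀ (α : MulAut G) (g : G), Nat.Coprime (orderOf g) (orderOf α) → α g = g)
    {p : ℕ} [hp : Fact p.Prime] (P : Sylow p G) : (P : Subgroup G).Normal := by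
  rw [← Subgroup.normalizer_eq_top_iff]
  refine Subgroup.eq_top_of_forall_exists_sylow_le _ fun q hq => ?_
  by_cases hpq : p = q
  · subst hpq
    exact ⟨P, Subgroup.le_normalizer⟩
  have := Fact.mk hq
  obtain ⟨Q⟩ : Nonempty (Sylow q G) := inferInstance
  refine ⟨Q, fun y hy => ?_⟩
  have hfix : ∀ z ∈ (Q : Subgroup G), ∀ x ∈ (P : Subgroup G), z * x * z⁻¹ = x := by
    intro z hz x hx
    refine h (MulAut.conj z) x (Nat.Coprime.coprime_dvd_right (orderOf_map_dvd _ z) ?_)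
    exact P.isPGroup'.coprime_orderOf hp.out hq hpq Q.isPGroup' hx hz
  rw [Subgroup.mem_normalizer_iff]
  refine fun x => ⟨fun hx => by rwa [hfix y hy x hx], fun hx => ?_⟩
  have := hfix _ (inv_mem hy) _ hx
  have hx' : x = y * x * y⁻¹ := by simpa [mul_assoc] using this
  rwa [hx']

theorem Sylow.exists_mem_autoSeries_succ_notMem
    (h : ∀ (α : MulAut G) (g : G), Nat.Coprime (orderOf g) (orderOf α) → α g = g)
    {p : ℕ} [hp : Fact p.Prime] (P : Sylow p G) (n : ℕ)
    (hPn : ¬ (P : Subgroup G) ≤ autoSeries G n) :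
    ∃ x, x ∈ autoSeries G (n + 1) ∧ x ∉ autoSeries G n := by
  have := P.normal_of_coprime_apply_eq h
  have hchar := P.characteristic_of_normal this
  have hPα (α : MulAut G) {y : G} (hy : y ∈ (P : Subgroup G)) : α y ∈ (P : Subgroup G) :=
    Subgroup.mem_comap.1 ((Subgroup.characteristic_iff_le_comap.1 hchar α) hy)
  set K := autoSeries G n
  have : K.Normal := ⟨fun x hx g => map_mem_autoSeries (MulAut.conj g) hx⟩
  let : MulAction.QuotientAction (MulAut G) K := ⟨fun α a b hab => by
    simpa using map_mem_autoSeries α hab⟩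
  obtain ⟨S⟩ : Nonempty (Sylow p (MulAut G)) := inferInstance
  let X : Subgroup (G ⧸ K) := (P : Subgroup G).map (QuotientGroup.mk' K)
  let Y : SubMulAction S (G ⧸ K) :=
    { carrier := X
      smul_mem' := by
        rintro ⟨α, hα⟩ _ ⟨y, hy, rfl⟩
        exact ⟨α y, hPα α hy, rfl⟩ }
  have hX : IsPGroup p X := P.isPGroup'.map _
  have hXne : X ≠ ⊥ := by
    intro hbot
    rw [Subgroup.map_eq_bot_iff, QuotientGroup.ker_mk'] at hbot
    exact hPn hbot
  have hdvd : p ∣ Nat.card Y := by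
    have : Nontrivial X := (Subgroup.nontrivial_iff_ne_bot X).2 hXne
    obtain ⟨k, hk, hcard⟩ := hX.nontrivial_iff_card.1 this
    change p ∣ Nat.card X
    rw [hcard]
    exact dvd_pow_self p hk.ne'
  have h1 : (⟨1, one_mem X⟩ : Y) ∈ MulAction.fixedPoints S Y := by
    rintro ⟨α, hα⟩
    refine Subtype.ext ?_
    change ((α 1 : G) : G ⧸ K) = ((1 : G) : G ⧸ K)
    rw [map_one]
  obtain ⟨⟨_, x, hxP, rfl⟩, hxfix, hxne⟩ :=
    S.isPGroup'.exists_fixed_point_of_prime_dvd_card_of_fixed_point Y hdvd h1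
  refine ⟨x, ?_, fun hxK => hxne (Subtype.ext ?_)⟩
  · have htop : MulAction.stabilizer (MulAut G) (x : G ⧸ K) = ⊤ := by
      refine Subgroup.eq_top_of_forall_exists_sylow_le _ fun q hq => ?_
      by_cases hpq : p = q
      · subst hpq
        exact ⟨S, fun α hα => congrArg Subtype.val (hxfix ⟨α, hα⟩)⟩
      · have := Fact.mk hq
        obtain ⟨Q⟩ : Nonempty (Sylow q (MulAut G)) := inferInstance
        refine ⟨Q, fun α hα => ?_⟩
        change ((α x : G) : G ⧸ K) = (x : G ⧸ K)
        rw [h α x (P.isPGroup'.coprime_orderOf hp.out hq hpq Q.isPGroup' hxP hα)]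
    refine mem_autoSeries_succ.2 fun α => QuotientGroup.eq.1 ?_
    have hα : α ∈ MulAction.stabilizer (MulAut G) (x : G ⧸ K) := htop ▸ Subgroup.mem_top α
    exact (MulAction.mem_stabilizer_iff.1 hα).symm
  · exact ((QuotientGroup.eq_one_iff x).2 hxK).symm

theorem autonilpotent_of_coprime_apply_eq
    (h : ∀ (α : MulAut G) (g : G), Nat.Coprime (orderOf g) (orderOf α) → α g = g) :
    Autonilpotent G := by
  obtain ⟨n, hn⟩ := WellFoundedGT.monotone_chain_condition
    (α := Subgroup G) ⟨autoSeries G, autoSeries_mono⟩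
  refine autonilpotent_iff_exists_autoSeries_eq_top.2
    ⟨n, Subgroup.eq_top_of_forall_exists_sylow_le _ fun p hp => ?_⟩
  have := Fact.mk hp
  obtain ⟨P⟩ : Nonempty (Sylow p G) := inferInstance
  refine ⟨P, by_contra fun hP => ?_⟩
  obtain ⟨x, hx, hx'⟩ := P.exists_mem_autoSeries_succ_notMem h n hP
  have heq : autoSeries G n = autoSeries G (n + 1) := hn (n + 1) n.le_succ
  exact hx' (heq ▸ hx)

end Sylow

/-- A finite group `G` is autonilpotent iff every automorphism `α` of `G` fixes every element
of `G` whose order is coprime to the order of `α`. -/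
theorem autonilpotent_iff_coprime_order_fixed (G : Type*) [Group G] [Finite G] :
    Autonilpotent G ↔
      ∀ (α : MulAut G) (g : G), Nat.Coprime (orderOf g) (orderOf α) → α g = g :=
  ⟨fun h => h.apply_eq_of_coprime, autonilpotent_of_coprime_apply_eq⟩
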